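/- For any field k, the category k-(co)HopfBr of cocommutative Hopf braces over k (objects: cocommutative Hopf braces; morphisms: morphisms of Hopf braces) is complete, i.e. it has all small limits. In particular, the product of a finite family of cocommutative Hopf braces is the tensor product of the underlying coalgebras with the Hopf brace structure obtained by transporting each multiplication, unit and antipode componentwise through the coalgebra projections. -/

import Mathlib

/-! Common definitions for formalizing "Constructing Hopf braces" (Agore). -/

open TensorProduct LinearMap

namespace HopfBraceNL

universe u

variable (k : Type u) [Field k]

section HopfStr

variable (V : Type u) [AddCommGroup V] [Module k V] [Coalgebra k V]

/-- The coalgebra `V` is cocommutative. -/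
def IsCocomm : Prop :=
  (TensorProduct.comm k V V).toLinearMap ∘ₗ (Coalgebra.comul (R := k) (A := V)) =
    Coalgebra.comul (R := k) (A := V)

/-- A Hopf algebra structure on the underlying coalgebra of `V`: a multiplication, unit and
antipode making `V` a Hopf algebra whose comultiplication and counit are the given ones. -/
structure HopfStr where
  mul : V ⊗[k] V →ₗ[k] V
  one : V
  mul_assoc : ∀ a b c : V, mul (mul (a ⊗ₜ[k] b) ⊗ₜ[k] c) = mul (a ⊗ₜ[k] mul (b ⊗ₜ[k] c))
  one_mul : ∀ a : V, mul (one ⊗ₜ[k] a) = a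
  mul_one : ∀ a : V, mul (a ⊗ₜ[k] one) = a
  comul_mul : ∀ a b : V,
    Coalgebra.comul (R := k) (mul (a ⊗ₜ[k] b)) =
      TensorProduct.map mul mul
        (TensorProduct.tensorTensorTensorComm k V V V V
          (Coalgebra.comul (R := k) a ⊗ₜ[k] Coalgebra.comul (R := k) b))
  counit_mul : ∀ a b : V,
    Coalgebra.counit (R := k) (mul (a ⊗ₜ[k] b)) =
      Coalgebra.counit (R := k) a * Coalgebra.counit (R := k) b
  comul_one : Coalgebra.comul (R := k) one = one ⊗ₜ[k] one
  counit_one : Coalgebra.counit (R := k) one = 1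
  antipode : V →ₗ[k] V
  antipode_left :
    mul ∘ₗ rTensor V antipode ∘ₗ Coalgebra.comul =
      toSpanSingleton k V one ∘ₗ Coalgebra.counit
  antipode_right :
    mul ∘ₗ lTensor V antipode ∘ₗ Coalgebra.comul =
      toSpanSingleton k V one ∘ₗ Coalgebra.counit

variable {k V}

/-- The Hopf structure is commutative. -/
def HopfStr.IsComm (hs : HopfStr k V) : Prop :=
  ∀ x y : V, hs.mul (x ⊗ₜ[k] y) = hs.mul (y ⊗ₜ[k] x)

/-- The linear map `x ⊗ y ⊗ z ↦ (x₍₁₎ ∘ y)·S(x₍₂₎)·(x₍₃₎ ∘ z)` (Sweedler notation), the right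
hand side of the Hopf brace compatibility condition, written point-free.  Here `m` and `S` are
the multiplication and antipode of the first Hopf structure and `m'` the multiplication of the
second one. -/
noncomputable def braceRHS (m : V ⊗[k] V →ₗ[k] V) (S : V →ₗ[k] V)
    (m' : V ⊗[k] V →ₗ[k] V) : V ⊗[k] (V ⊗[k] V) →ₗ[k] V :=
  m ∘ₗ lTensor V m
    ∘ₗ TensorProduct.map m' (TensorProduct.map S m')
    ∘ₗ lTensor (V ⊗[k] V) (TensorProduct.assoc k V V V).toLinearMap
    ∘ₗ (TensorProduct.tensorTensorTensorComm k V (V ⊗[k] V) V V).toLinearMap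
    ∘ₗ rTensor (V ⊗[k] V)
        ((lTensor V (Coalgebra.comul (R := k))) ∘ₗ (Coalgebra.comul (R := k) (A := V)))

variable (k V) in
/-- A Hopf brace on the coalgebra `V`: two Hopf algebra structures subject to the compatibility
`x ∘ (y·z) = (x₍₁₎ ∘ y)·S(x₍₂₎)·(x₍₃₎ ∘ z)`. -/
structure HopfBrace where
  dot : HopfStr k V
  circ : HopfStr k V
  brace : circ.mul ∘ₗ lTensor V dot.mul = braceRHS dot.mul dot.antipode circ.mul

/-- A solution of the braid equation on `V ⊗ V`. -/
def SolvesBraid {W : Type u} [AddCommGroup W] [Module k W]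
    (c : W ⊗[k] W →ₗ[k] W ⊗[k] W) : Prop :=
  letI c₁ : (W ⊗[k] W) ⊗[k] W →ₗ[k] (W ⊗[k] W) ⊗[k] W := rTensor W c
  letI c₂ : (W ⊗[k] W) ⊗[k] W →ₗ[k] (W ⊗[k] W) ⊗[k] W :=
    (TensorProduct.assoc k W W W).symm.toLinearMap ∘ₗ lTensor W c ∘ₗ
      (TensorProduct.assoc k W W W).toLinearMap
  c₁ ∘ₗ c₂ ∘ₗ c₁ = c₂ ∘ₗ c₁ ∘ₗ c₂

end HopfStr

section Actions

variable {k}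
variable {A H : Type u}
  [AddCommGroup A] [Module k A] [Coalgebra k A]
  [AddCommGroup H] [Module k H] [Coalgebra k H]

/-- `(x, a) ↦ (x₍₁₎ ⊗ a₍₁₎) ⊗ (x₍₂₎ ⊗ a₍₂₎)`, as an element. -/
noncomputable def split (x : H) (a : A) : (H ⊗[k] A) ⊗[k] (H ⊗[k] A) :=
  TensorProduct.tensorTensorTensorComm k H H A A
    (Coalgebra.comul (R := k) x ⊗ₜ[k] Coalgebra.comul (R := k) a)

/-- `A` is a left module over the Hopf structure `hH` via `act`. -/
structure IsLeftModule (hH : HopfStr k H) (act : H ⊗[k] A →ₗ[k] A) : Prop where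
  one_act : ∀ a : A, act (hH.one ⊗ₜ[k] a) = a
  mul_act : ∀ (x y : H) (a : A),
    act (hH.mul (x ⊗ₜ[k] y) ⊗ₜ[k] a) = act (x ⊗ₜ[k] act (y ⊗ₜ[k] a))

/-- `A` is a left module over `hH`-op via `act`, i.e. `(xy) ▶ a = y ▶ (x ▶ a)`. -/
structure IsLeftOpModule (hH : HopfStr k H) (act : H ⊗[k] A →ₗ[k] A) : Prop where
  one_act : ∀ a : A, act (hH.one ⊗ₜ[k] a) = a
  mul_act : ∀ (x y : H) (a : A),
    act (hH.mul (x ⊗ₜ[k] y) ⊗ₜ[k] a) = act (y ⊗ₜ[k] act (x ⊗ₜ[k] a))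

/-- The measuring conditions: `x ▶ (ab) = (x₍₁₎ ▶ a)(x₍₂₎ ▶ b)` and `x ▶ 1 = ε(x)1`. -/
structure IsModuleAlgebraLaw (hA : HopfStr k A) (act : H ⊗[k] A →ₗ[k] A) : Prop where
  act_mul : ∀ (x : H) (a b : A),
    act (x ⊗ₜ[k] hA.mul (a ⊗ₜ[k] b)) =
      hA.mul (TensorProduct.map act act
        (TensorProduct.tensorTensorTensorComm k H H A A
          (Coalgebra.comul (R := k) x ⊗ₜ[k] (a ⊗ₜ[k] b))))
  act_one : ∀ x : H, act (x ⊗ₜ[k] hA.one) = Coalgebra.counit (R := k) x • hA.one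

/-- `act` is a coalgebra map: `Δ(x ▶ a) = (x₍₁₎ ▶ a₍₁₎) ⊗ (x₍₂₎ ▶ a₍₂₎)`,
`ε(x ▶ a) = ε(x)ε(a)`. -/
structure IsCoalgebraLaw (act : H ⊗[k] A →ₗ[k] A) : Prop where
  comul_act : ∀ (x : H) (a : A),
    Coalgebra.comul (R := k) (act (x ⊗ₜ[k] a)) = TensorProduct.map act act (split x a)
  counit_act : ∀ (x : H) (a : A),
    Coalgebra.counit (R := k) (act (x ⊗ₜ[k] a)) =
      Coalgebra.counit (R := k) x * Coalgebra.counit (R := k) a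

/-- `(A, act)` is a left `hH`-module algebra. -/
structure IsLeftModuleAlgebra (hH : HopfStr k H) (hA : HopfStr k A)
    (act : H ⊗[k] A →ₗ[k] A) : Prop where
  toIsLeftModule : IsLeftModule hH act
  toLaw : IsModuleAlgebraLaw hA act

/-- `(A, act)` is a left `hH`-module coalgebra. -/
structure IsLeftModuleCoalgebra (hH : HopfStr k H) (act : H ⊗[k] A →ₗ[k] A) : Prop where
  toIsLeftModule : IsLeftModule hH act
  toCoalgLaw : IsCoalgebraLaw act

/-- `(A, act)` is a left `hH`-module bialgebra. -/
structure IsLeftModuleBialgebra (hH : HopfStr k H) (hA : HopfStr k A)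
    (act : H ⊗[k] A →ₗ[k] A) : Prop where
  toIsLeftModule : IsLeftModule hH act
  toLaw : IsModuleAlgebraLaw hA act
  toCoalgLaw : IsCoalgebraLaw act

/-- `(A, act)` is a left `hH`-op-module bialgebra. -/
structure IsLeftOpModuleBialgebra (hH : HopfStr k H) (hA : HopfStr k A)
    (act : H ⊗[k] A →ₗ[k] A) : Prop where
  toIsLeftOpModule : IsLeftOpModule hH act
  toLaw : IsModuleAlgebraLaw hA act
  toCoalgLaw : IsCoalgebraLaw act

/-- `H` is a right module over the Hopf structure `hA` via `ract : H ⊗ A → H`. -/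
structure IsRightModule (hA : HopfStr k A) (ract : H ⊗[k] A →ₗ[k] H) : Prop where
  act_one : ∀ x : H, ract (x ⊗ₜ[k] hA.one) = x
  act_mul : ∀ (x : H) (a b : A),
    ract (x ⊗ₜ[k] hA.mul (a ⊗ₜ[k] b)) = ract (ract (x ⊗ₜ[k] a) ⊗ₜ[k] b)

/-- `ract` is a coalgebra map `H ⊗ A → H`. -/
structure IsRightCoalgebraLaw (ract : H ⊗[k] A →ₗ[k] H) : Prop where
  comul_act : ∀ (x : H) (a : A),
    Coalgebra.comul (R := k) (ract (x ⊗ₜ[k] a)) = TensorProduct.map ract ract (split x a)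
  counit_act : ∀ (x : H) (a : A),
    Coalgebra.counit (R := k) (ract (x ⊗ₜ[k] a)) =
      Coalgebra.counit (R := k) x * Coalgebra.counit (R := k) a

/-- `(H, ract)` is a right `hA`-module bialgebra:  in addition to the module and coalgebra
conditions, `(xy) ◁ a = (x ◁ a₍₁₎)(y ◁ a₍₂₎)` and `1 ◁ a = ε(a)1`. -/
structure IsRightModuleBialgebra (hA : HopfStr k A) (hH : HopfStr k H)
    (ract : H ⊗[k] A →ₗ[k] H) : Prop where
  toIsRightModule : IsRightModule hA ract
  mul_ract : ∀ (x y : H) (a : A),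
    ract (hH.mul (x ⊗ₜ[k] y) ⊗ₜ[k] a) =
      hH.mul (TensorProduct.map ract ract
        (TensorProduct.tensorTensorTensorComm k H H A A
          ((x ⊗ₜ[k] y) ⊗ₜ[k] Coalgebra.comul (R := k) a)))
  one_ract : ∀ a : A, ract (hH.one ⊗ₜ[k] a) = Coalgebra.counit (R := k) a • hH.one
  toCoalgLaw : IsRightCoalgebraLaw ract

/-- `(A, H, tri, quad)` is a matched pair of Hopf algebras. -/
structure IsMatchedPair (hA : HopfStr k A) (hH : HopfStr k H)
    (tri : H ⊗[k] A →ₗ[k] A) (quad : H ⊗[k] A →ₗ[k] H) : Prop where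
  tri_module : IsLeftModule hH tri
  tri_coalg : IsCoalgebraLaw tri
  quad_module : IsRightModule hA quad
  quad_coalg : IsRightCoalgebraLaw quad
  mp1 : ∀ x : H, tri (x ⊗ₜ[k] hA.one) = Coalgebra.counit (R := k) x • hA.one
  mp1' : ∀ a : A, quad (hH.one ⊗ₜ[k] a) = Coalgebra.counit (R := k) a • hH.one
  mp2 : ∀ (x : H) (a b : A),
    tri (x ⊗ₜ[k] hA.mul (a ⊗ₜ[k] b)) =
      hA.mul (lTensor A tri (TensorProduct.assoc k A H A
        ((TensorProduct.map tri quad (split x a)) ⊗ₜ[k] b)))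
  mp3 : ∀ (x y : H) (a : A),
    quad (hH.mul (x ⊗ₜ[k] y) ⊗ₜ[k] a) =
      hH.mul (rTensor H quad ((TensorProduct.assoc k H A H).symm
        (x ⊗ₜ[k] TensorProduct.map tri quad (split y a))))
  mp4 : ∀ (x : H) (a : A),
    TensorProduct.map quad tri (split x a) =
      TensorProduct.comm k A H (TensorProduct.map tri quad (split x a))

variable (k) in
/-- `(a ⊗ (u₁ ⊗ u₂)) ⊗ y ↦ mA (a ⊗ u₁) ⊗ mH (u₂ ⊗ y)`: the standard way to assemble
a multiplication on `A ⊗ H` from a middle term `u ∈ A ⊗ H`. -/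
noncomputable def sandwich (mA : A ⊗[k] A →ₗ[k] A) (mH : H ⊗[k] H →ₗ[k] H) :
    (A ⊗[k] (A ⊗[k] H)) ⊗[k] H →ₗ[k] A ⊗[k] H :=
  TensorProduct.map mA mH
    ∘ₗ (TensorProduct.assoc k (A ⊗[k] A) H H).toLinearMap
    ∘ₗ rTensor H (TensorProduct.assoc k A A H).symm.toLinearMap

variable (k) in
/-- `(m ⊗ n) ⊗ p ↦ (m ⊗ p) ⊗ n`. -/
noncomputable def rightComm (M N P : Type u) [AddCommGroup M] [Module k M]
    [AddCommGroup N] [Module k N] [AddCommGroup P] [Module k P] :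
    (M ⊗[k] N) ⊗[k] P →ₗ[k] (M ⊗[k] P) ⊗[k] N :=
  (TensorProduct.assoc k M P N).symm.toLinearMap
    ∘ₗ lTensor M (TensorProduct.comm k N P).toLinearMap
    ∘ₗ (TensorProduct.assoc k M N P).toLinearMap

/-- `(x, b) ↦ (x₍₁₎ ▷ b₍₁₎) ⊗ (x₍₂₎ ◁ b₍₂₎)`. -/
noncomputable def matchedEl (tri : H ⊗[k] A →ₗ[k] A) (quad : H ⊗[k] A →ₗ[k] H)
    (x : H) (b : A) : A ⊗[k] H :=
  TensorProduct.map tri quad (split x b)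

/-- `(x, b) ↦ (x₍₁₎ ▷ b) ⊗ x₍₂₎`. -/
noncomputable def smashEl (tri : H ⊗[k] A →ₗ[k] A) (x : H) (b : A) : A ⊗[k] H :=
  rTensor H tri (rightComm k H H A (Coalgebra.comul (R := k) x ⊗ₜ[k] b))

/-- `(x, b) ↦ b₍₁₎ ⊗ (x ◁ b₍₂₎)`. -/
noncomputable def rsmashEl (ract : H ⊗[k] A →ₗ[k] H) (x : H) (b : A) : A ⊗[k] H :=
  lTensor A ract (TensorProduct.leftComm k H A A (x ⊗ₜ[k] Coalgebra.comul (R := k) b))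

end Actions

section Morphisms

variable {k}
variable {A B : Type u}
  [AddCommGroup A] [Module k A] [Coalgebra k A]
  [AddCommGroup B] [Module k B] [Coalgebra k B]

/-- A morphism of Hopf braces: a `k`-linear map which is a morphism of Hopf algebras for both
Hopf algebra structures (in particular a coalgebra morphism). -/
structure IsHopfBraceHom (BA : HopfBrace k A) (BB : HopfBrace k B) (f : A →ₗ[k] B) : Prop where
  comul_comp : ∀ a : A,
    Coalgebra.comul (R := k) (f a) = TensorProduct.map f f (Coalgebra.comul (R := k) a)
  counit_comp : ∀ a : A, Coalgebra.counit (R := k) (f a) = Coalgebra.counit (R := k) a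
  map_mul : ∀ a b : A, f (BA.dot.mul (a ⊗ₜ[k] b)) = BB.dot.mul (f a ⊗ₜ[k] f b)
  map_one : f BA.dot.one = BB.dot.one
  map_cmul : ∀ a b : A, f (BA.circ.mul (a ⊗ₜ[k] b)) = BB.circ.mul (f a ⊗ₜ[k] f b)
  map_cone : f BA.circ.one = BB.circ.one

theorem IsHopfBraceHom.id (BA : HopfBrace k A) : IsHopfBraceHom BA BA LinearMap.id := by
  constructor <;> simp [TensorProduct.map_id]

theorem IsHopfBraceHom.comp {C : Type u} [AddCommGroup C] [Module k C] [Coalgebra k C]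
    {BA : HopfBrace k A} {BB : HopfBrace k B} {BC : HopfBrace k C}
    {f : A →ₗ[k] B} {g : B →ₗ[k] C}
    (hf : IsHopfBraceHom BA BB f) (hg : IsHopfBraceHom BB BC g) :
    IsHopfBraceHom BA BC (g ∘ₗ f) := by
  constructor
  · intro a
    simp only [LinearMap.comp_apply, hg.comul_comp, hf.comul_comp, TensorProduct.map_comp]
  · intro a; simp [hg.counit_comp, hf.counit_comp]
  · intro a b; simp [hf.map_mul, hg.map_mul]
  · simp [hf.map_one, hg.map_one]
  · intro a b; simp [hf.map_cmul, hg.map_cmul]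
  · simp [hf.map_cone, hg.map_cone]

end Morphisms

/-- The category `k`-(co)HopfBr of cocommutative Hopf braces over `k`. -/
structure CocommHopfBraceCat (k : Type u) [Field k] : Type (u + 1) where
  /-- the underlying type -/
  carrier : Type u
  [isAddCommGroup : AddCommGroup carrier]
  [isModule : Module k carrier]
  [isCoalgebra : Coalgebra k carrier]
  /-- the Hopf brace structure -/
  brace : HopfBrace k carrier
  /-- the underlying coalgebra is cocommutative -/
  cocomm : IsCocomm k carrier

attribute [instance] CocommHopfBraceCat.isAddCommGroup CocommHopfBraceCat.isModule
  CocommHopfBraceCat.isCoalgebra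

noncomputable instance : CategoryTheory.Category (CocommHopfBraceCat k) where
  Hom X Y := { f : X.carrier →ₗ[k] Y.carrier // IsHopfBraceHom X.brace Y.brace f }
  id X := ⟨LinearMap.id, IsHopfBraceHom.id X.brace⟩
  comp f g := ⟨g.1 ∘ₗ f.1, f.2.comp g.2⟩
  id_comp f := Subtype.ext (LinearMap.comp_id f.1)
  comp_id f := Subtype.ext (LinearMap.id_comp f.1)
  assoc f g h := Subtype.ext (LinearMap.comp_assoc f.1 g.1 h.1).symm

/-- The first coalgebra projection `X ⊗ Y → X`, `x ⊗ y ↦ ε(y)x`. -/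
noncomputable def projL (X Y : Type u) [AddCommGroup X] [Module k X] [Coalgebra k X]
    [AddCommGroup Y] [Module k Y] [Coalgebra k Y] : X ⊗[k] Y →ₗ[k] X :=
  (TensorProduct.rid k X).toLinearMap ∘ₗ lTensor X (Coalgebra.counit (R := k) (A := Y))

/-- The second coalgebra projection `X ⊗ Y → Y`, `x ⊗ y ↦ ε(x)y`. -/
noncomputable def projR (X Y : Type u) [AddCommGroup X] [Module k X] [Coalgebra k X]
    [AddCommGroup Y] [Module k Y] [Coalgebra k Y] : X ⊗[k] Y →ₗ[k] Y :=
  (TensorProduct.lid k Y).toLinearMap ∘ₗ rTensor Y (Coalgebra.counit (R := k) (A := X))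

section Coideals

variable {k}
variable {C D : Type u} [AddCommGroup C] [Module k C] [Coalgebra k C]
  [AddCommGroup D] [Module k D] [Coalgebra k D]

theorem isCoideal_ker (f : C →ₗc[k] D) : (ker (f : C →ₗ[k] D)).IsCoideal where
  counit_eq_zero x hx := by
    have hx' : f x = 0 := hx
    rw [← CoalgHomClass.counit_comp_apply f x, hx', map_zero]
  map_mkQ_comul_eq_zero x hx := by
    set g : C →ₗ[k] D := (f : C →ₗ[k] D)
    set i := (ker g).liftQ g le_rfl
    have hi : Function.Injective i := ker_eq_bot.mp (Submodule.ker_liftQ_eq_bot _ _ _ le_rfl)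
    apply TensorProduct.map_injective_of_flat_flat i i hi hi
    have hx' : f x = 0 := hx
    rw [← LinearMap.comp_apply, ← TensorProduct.map_comp, Submodule.liftQ_mkQ, map_zero]
    rw [CoalgHomClass.map_comp_comul_apply f x, hx', map_zero]

theorem isCoideal_range_sub (f g : C →ₗc[k] D) :
    (range ((f : C →ₗ[k] D) - (g : C →ₗ[k] D))).IsCoideal where
  counit_eq_zero := by
    rintro _ ⟨x, rfl⟩
    simp
  map_mkQ_comul_eq_zero := by
    rintro _ ⟨x, rfl⟩
    set I := range ((f : C →ₗ[k] D) - (g : C →ₗ[k] D))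
    have h : I.mkQ ∘ₗ (f : C →ₗ[k] D) = I.mkQ ∘ₗ (g : C →ₗ[k] D) := by
      ext y
      exact (Submodule.Quotient.eq I).mpr ⟨y, rfl⟩
    have hf := CoalgHomClass.map_comp_comul_apply f x
    have hg := CoalgHomClass.map_comp_comul_apply g x
    rw [LinearMap.sub_apply, map_sub, map_sub]
    simp only [CoalgHom.coe_toLinearMap]
    rw [← hf, ← hg, ← LinearMap.comp_apply, ← LinearMap.comp_apply (TensorProduct.map I.mkQ I.mkQ),
      ← TensorProduct.map_comp, ← TensorProduct.map_comp, h, sub_self]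

theorem isCoideal_sSup (S : Set (Submodule k C)) (hS : ∀ I ∈ S, I.IsCoideal) :
    (sSup S).IsCoideal where
  counit_eq_zero := by
    have h : sSup S ≤ ker (Coalgebra.counit (R := k) (A := C)) :=
      sSup_le fun I hI x hx => (hS I hI).counit_eq_zero hx
    exact fun x hx => h hx
  map_mkQ_comul_eq_zero := by
    have h : sSup S ≤ ker (TensorProduct.map (sSup S).mkQ (sSup S).mkQ ∘ₗ
        Coalgebra.comul (R := k) (A := C)) := by
      refine sSup_le fun I hI x hx => ?_
      have hle : I ≤ sSup S := le_sSup hI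
      have hfac : (sSup S).mkQ = Submodule.factor hle ∘ₗ I.mkQ := rfl
      rw [LinearMap.mem_ker, LinearMap.comp_apply, hfac, TensorProduct.map_comp,
        LinearMap.comp_apply, (hS I hI).map_mkQ_comul_eq_zero hx, map_zero]
    exact fun x hx => h hx

theorem isCocomm_quotient [Coalgebra.IsCocomm k C] (I : Submodule k C) [I.IsCoideal] :
    Coalgebra.IsCocomm k (C ⧸ I) where
  comm_comp_comul := by
    ext x
    have h := Coalgebra.comm_comul k x
    simp only [LinearMap.comp_apply, LinearEquiv.coe_coe, Submodule.mkQ_apply,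
      Coalgebra.Quotient.comul_mk]
    rw [← TensorProduct.map_comm, h]

end Coideals

section Subcoalgebras

variable {k}
variable {C : Type u} [AddCommGroup C] [Module k C] [Coalgebra k C]

/-- A comultiplication-stable subspace, given by an injective linear map, is a coalgebra. -/
theorem exists_coalgebra_of_injective [Coalgebra.IsCocomm k C] {Q : Type u} [AddCommGroup Q]
    [Module k Q] (i : Q →ₗ[k] C) (hi : Function.Injective i)
    (h : ∀ q, Coalgebra.comul (R := k) (i q) ∈ range (TensorProduct.map i i)) :
    ∃ (_inst : Coalgebra k Q) (_ : Coalgebra.IsCocomm k Q) (f : Q →ₗc[k] C), (f : Q →ₗ[k] C) = i := by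
  have hii : Function.Injective (TensorProduct.map i i) :=
    TensorProduct.map_injective_of_flat_flat i i hi hi
  have hiii : Function.Injective (TensorProduct.map i (TensorProduct.map i i)) :=
    TensorProduct.map_injective_of_flat_flat _ _ hi hii
  obtain ⟨d, hd⟩ : ∃ d : Q →ₗ[k] Q ⊗[k] Q,
      ∀ q, TensorProduct.map i i (d q) = Coalgebra.comul (R := k) (i q) := by
    refine ⟨(LinearEquiv.ofInjective _ hii).symm.toLinearMap ∘ₗ
      (Coalgebra.comul ∘ₗ i).codRestrict _ h, fun q => ?_⟩
    have := (LinearEquiv.ofInjective _ hii).apply_symm_apply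
      ((Coalgebra.comul ∘ₗ i).codRestrict _ h q)
    exact congrArg Subtype.val this
  have hd' : TensorProduct.map i i ∘ₗ d = Coalgebra.comul ∘ₗ i := LinearMap.ext hd
  have hcoassoc : (TensorProduct.assoc k Q Q Q).toLinearMap ∘ₗ d.rTensor Q ∘ₗ d =
      d.lTensor Q ∘ₗ d := by
    ext q
    apply hiii
    have h1 : TensorProduct.map i (TensorProduct.map i i) ∘ₗ
        (TensorProduct.assoc k Q Q Q).toLinearMap ∘ₗ rTensor Q d =
        (TensorProduct.assoc k C C C).toLinearMap ∘ₗ rTensor C Coalgebra.comul ∘ₗ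
          TensorProduct.map i i := by
      rw [← LinearMap.comp_assoc, TensorProduct.map_map_comp_assoc_eq, LinearMap.comp_assoc,
        map_comp_rTensor, rTensor_comp_map, hd']
    have h2 : TensorProduct.map i (TensorProduct.map i i) ∘ₗ lTensor Q d =
        lTensor C Coalgebra.comul ∘ₗ TensorProduct.map i i := by
      rw [map_comp_lTensor, lTensor_comp_map, hd']
    have e1 := LinearMap.congr_fun h1 (d q)
    have e2 := LinearMap.congr_fun h2 (d q)
    simp only [LinearMap.comp_apply, LinearEquiv.coe_coe, hd] at e1 e2 ⊢
    rw [e1, e2, Coalgebra.coassoc_apply]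
  have hleft : (Coalgebra.counit ∘ₗ i).rTensor Q ∘ₗ d = TensorProduct.mk k _ _ 1 := by
    ext q
    apply Module.Flat.lTensor_preserves_injective_linearMap (M := k) i hi
    have h1 : lTensor k i ∘ₗ rTensor Q (Coalgebra.counit ∘ₗ i) =
        rTensor C (Coalgebra.counit (R := k)) ∘ₗ TensorProduct.map i i := by
      ext; simp
    have e1 := LinearMap.congr_fun h1 (d q)
    simp only [LinearMap.comp_apply, hd] at e1 ⊢
    rw [e1]
    simp
  have hright : (Coalgebra.counit ∘ₗ i).lTensor Q ∘ₗ d = (TensorProduct.mk k _ _).flip 1 := by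
    ext q
    apply Module.Flat.rTensor_preserves_injective_linearMap (M := k) i hi
    have h1 : rTensor k i ∘ₗ lTensor Q (Coalgebra.counit ∘ₗ i) =
        lTensor C (Coalgebra.counit (R := k)) ∘ₗ TensorProduct.map i i := by
      ext; simp
    have e1 := LinearMap.congr_fun h1 (d q)
    simp only [LinearMap.comp_apply, hd] at e1 ⊢
    rw [e1]
    simp
  let inst : Coalgebra k Q :=
    { comul := d
      counit := Coalgebra.counit ∘ₗ i
      coassoc := hcoassoc
      rTensor_counit_comp_comul := hleft
      lTensor_counit_comp_comul := hright }
  refine ⟨inst, ⟨?_⟩, ⟨i, rfl, hd'⟩, rfl⟩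
  ext q
  apply hii
  have hq : Coalgebra.comul (R := k) q = d q := rfl
  simp only [LinearMap.comp_apply, LinearEquiv.coe_coe]
  rw [TensorProduct.map_comm, hq, hd, Coalgebra.comm_comul]

/-- Every element of a coalgebra lies in a subcoalgebra of countable dimension. -/
theorem exists_countable_comul_stable (c : C) :
    ∃ g : (ℕ →₀ k) →ₗ[k] C, c ∈ range g ∧
      ∀ x ∈ range g, Coalgebra.comul (R := k) x ∈ range (TensorProduct.map g g) := by
  choose S hS using fun x : C => TensorProduct.exists_finset (Coalgebra.comul (R := k) x)
  set e : C → Set C := fun x => Prod.fst '' (S x : Set (C × C)) ∪ Prod.snd '' (S x : Set (C × C))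
  have he : ∀ x, (e x).Countable := fun x =>
    ((S x).countable_toSet.image _).union ((S x).countable_toSet.image _)
  set s : ℕ → Set C := fun n => n.rec {c} fun _ t => ⋃ x ∈ t, e x
  have hs : ∀ n, (s n).Countable := fun n => by
    induction n with
    | zero => exact Set.countable_singleton c
    | succ n ih => exact ih.biUnion fun x _ => he x
  have hc : c ∈ ⋃ n, s n := Set.mem_iUnion.mpr ⟨0, rfl⟩
  obtain ⟨u, hu⟩ := (Set.countable_iUnion hs).exists_eq_range ⟨c, hc⟩
  have hmem : ∀ y ∈ ⋃ n, s n, ∃ m, Finsupp.linearCombination k u (Finsupp.single m 1) = y := by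
    intro y hy
    rw [hu] at hy
    obtain ⟨m, rfl⟩ := hy
    exact ⟨m, by simp⟩
  have hclosed : ∀ x ∈ ⋃ n, s n, e x ⊆ ⋃ n, s n := by
    intro x hx y hy
    obtain ⟨n, hn⟩ := Set.mem_iUnion.mp hx
    exact Set.mem_iUnion.mpr ⟨n + 1, Set.mem_biUnion hn hy⟩
  refine ⟨Finsupp.linearCombination k u, ?_, ?_⟩
  · obtain ⟨m, hm⟩ := hmem c hc
    exact ⟨_, hm⟩
  · have hle : range (Finsupp.linearCombination k u) ≤
        (range (TensorProduct.map (Finsupp.linearCombination k u)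
          (Finsupp.linearCombination k u))).comap Coalgebra.comul := by
      rw [Finsupp.range_linearCombination, ← hu, Submodule.span_le]
      intro x hx
      rw [SetLike.mem_coe, Submodule.mem_comap, hS x]
      refine Submodule.sum_mem _ fun p hp => ?_
      obtain ⟨m, hm⟩ := hmem p.1 (hclosed x hx (Or.inl ⟨p, hp, rfl⟩))
      obtain ⟨n, hn⟩ := hmem p.2 (hclosed x hx (Or.inr ⟨p, hp, rfl⟩))
      exact ⟨Finsupp.single m 1 ⊗ₜ Finsupp.single n 1, by rw [TensorProduct.map_tmul, hm, hn]⟩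
    exact fun x hx => hle hx

end Subcoalgebras

section DirectSum

variable {k}
variable {ι : Type u} [DecidableEq ι] (M : ι → Type u) [∀ i, AddCommGroup (M i)]
  [∀ i, Module k (M i)] [∀ i, Coalgebra k (M i)]

/-- The inclusion of a summand of a direct sum of coalgebras. -/
noncomputable def lsingleCoalgHom (i : ι) : M i →ₗc[k] Π₀ i, M i where
  toLinearMap := DFinsupp.lsingle i
  counit_comp := DFinsupp.counit_comp_lsingle k ι M i
  map_comp_comul := (DFinsupp.comul_comp_lsingle k ι M i).symm

variable {M} {D : Type u} [AddCommGroup D] [Module k D] [Coalgebra k D]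

/-- The coalgebra map out of a direct sum given by a family of coalgebra maps. -/
noncomputable def lsumCoalgHom (g : ∀ i, M i →ₗc[k] D) : (Π₀ i, M i) →ₗc[k] D :=
  have hp : ∀ i, DFinsupp.lsum k (fun i => (g i : M i →ₗ[k] D)) ∘ₗ DFinsupp.lsingle i =
      (g i : M i →ₗ[k] D) :=
    fun i => by ext x; simp
  { DFinsupp.lsum k fun i => (g i : M i →ₗ[k] D) with
    counit_comp := by
      refine DFinsupp.lhom_ext' fun i => ?_
      rw [LinearMap.comp_assoc]
      erw [hp i]
      rw [DFinsupp.counit_comp_lsingle, CoalgHomClass.counit_comp]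
    map_comp_comul := by
      refine DFinsupp.lhom_ext' fun i => ?_
      rw [LinearMap.comp_assoc, LinearMap.comp_assoc, DFinsupp.comul_comp_lsingle]
      erw [hp i]
      rw [← LinearMap.comp_assoc, ← TensorProduct.map_comp]
      erw [hp i]
      exact CoalgHomClass.map_comp_comul (g i) }

theorem lsumCoalgHom_comp_lsingle (g : ∀ i, M i →ₗc[k] D) (i : ι) :
    (lsumCoalgHom g).comp (lsingleCoalgHom M i) = g i := by
  refine CoalgHom.coe_linearMap_injective ?_
  ext x
  exact DFinsupp.lsum_single (R := k) (S := k) (fun i => (g i : M i →ₗ[k] D)) i x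

end DirectSum

section Cones

universe v

variable {k}
variable {J : Type v} {A : J → Type u} [∀ j, AddCommGroup (A j)] [∀ j, Module k (A j)]
  [∀ j, Coalgebra k (A j)]

/-- A cocommutative coalgebra with coalgebra maps to all `A j`, compatible with the prescribed
linear maps `R i j` from `A i` to `A j`. -/
structure CocommCone (R : ∀ i j, Set (A i →ₗ[k] A j)) where
  /-- the underlying type of the apex -/
  carrier : Type u
  [isAddCommGroup : AddCommGroup carrier]
  [isModule : Module k carrier]
  [isCoalgebra : Coalgebra k carrier]
  [isCocomm : Coalgebra.IsCocomm k carrier]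
  /-- the legs of the cone -/
  π : ∀ j, carrier →ₗc[k] A j
  compat : ∀ i j, ∀ f ∈ R i j, f ∘ₗ (π i : carrier →ₗ[k] A i) = (π j : carrier →ₗ[k] A j)

attribute [instance] CocommCone.isAddCommGroup CocommCone.isModule CocommCone.isCoalgebra
  CocommCone.isCocomm

namespace CocommCone

variable {R : ∀ i j, Set (A i →ₗ[k] A j)}

/-- Precomposition of a cone with a coalgebra map. -/
def precomp (L : CocommCone R) {C : Type u} [AddCommGroup C] [Module k C] [Coalgebra k C]
    [Coalgebra.IsCocomm k C] (g : C →ₗc[k] L.carrier) : CocommCone R where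
  carrier := C
  π j := (L.π j).comp g
  compat i j f hf := by
    rw [CoalgHom.comp_toLinearMap, CoalgHom.comp_toLinearMap, ← LinearMap.comp_assoc,
      L.compat i j f hf]

/-- The cone `L` is terminal among all cones. -/
def IsTerminal (L : CocommCone R) : Prop :=
  ∀ C : CocommCone R, ∃! f : C.carrier →ₗc[k] L.carrier, ∀ j, (L.π j).comp f = C.π j

/-- The apex contains no nonzero coideal annihilated by all the legs. -/
def IsReduced (L : CocommCone R) : Prop :=
  ∀ I : Submodule k L.carrier, I.IsCoideal →
    (∀ j, I ≤ ker (L.π j : L.carrier →ₗ[k] A j)) → I = ⊥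

theorem IsReduced.hom_ext {L : CocommCone R} (hL : L.IsReduced) {C : Type u} [AddCommGroup C]
    [Module k C] [Coalgebra k C] {f g : C →ₗc[k] L.carrier}
    (h : ∀ j, (L.π j).comp f = (L.π j).comp g) : f = g := by
  have h0 := hL _ (isCoideal_range_sub f g) (by
    rintro j _ ⟨x, rfl⟩
    have := CoalgHom.congr_fun (h j) x
    simpa [sub_eq_zero] using this)
  rw [LinearMap.range_eq_bot, sub_eq_zero] at h0
  exact CoalgHom.coe_linearMap_injective h0

theorem exists_reduced (C : CocommCone R) :
    ∃ (L : CocommCone R) (q : C.carrier →ₗc[k] L.carrier), L.IsReduced ∧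
      Function.Surjective q ∧ ∀ j, (L.π j).comp q = C.π j := by
  set S : Set (Submodule k C.carrier) :=
    {I | I.IsCoideal ∧ ∀ j, I ≤ ker (C.π j : C.carrier →ₗ[k] A j)}
  have : (sSup S).IsCoideal := isCoideal_sSup S fun I hI => hI.1
  have := isCocomm_quotient (sSup S)
  have hker : ∀ j, sSup S ≤ ker (C.π j : C.carrier →ₗ[k] A j) := fun j =>
    sSup_le fun I hI => hI.2 j
  let p : ∀ j, (C.carrier ⧸ sSup S) →ₗc[k] A j := fun j =>
    { (sSup S).liftQ (C.π j : C.carrier →ₗ[k] A j) (hker j) with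
      counit_comp := by
        ext x
        simp
      map_comp_comul := by
        ext x
        have hx := CoalgHomClass.map_comp_comul_apply (C.π j) x
        simp only [LinearMap.comp_apply, Submodule.mkQ_apply, Coalgebra.Quotient.comul_mk]
        rw [← LinearMap.comp_apply, ← TensorProduct.map_comp, Submodule.liftQ_mkQ, hx]
        rfl }
  let L : CocommCone R :=
    { carrier := C.carrier ⧸ sSup S
      π := p
      compat := fun i j f hf => by
        ext x
        exact LinearMap.congr_fun (C.compat i j f hf) x }
  refine ⟨L, Coalgebra.Quotient.mkQCoalgHom (sSup S), ?_, Submodule.mkQ_surjective _,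
    fun j => rfl⟩
  intro I hI hIL
  let r := (@Coalgebra.Quotient.mkQCoalgHom k _ _ _ _ _ I hI).comp
    (Coalgebra.Quotient.mkQCoalgHom (R := k) (sSup S))
  have hr : ∀ x : C.carrier, x ∈ ker (r : C.carrier →ₗ[k] L.carrier ⧸ I) ↔
      (sSup S).mkQ x ∈ I := fun x => Submodule.Quotient.mk_eq_zero I
  have hle : ker (r : C.carrier →ₗ[k] L.carrier ⧸ I) ≤ sSup S :=
    le_sSup ⟨isCoideal_ker r, fun j x hx => hIL j ((hr x).mp hx)⟩
  rw [eq_bot_iff]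
  intro y hy
  obtain ⟨x, rfl⟩ := (sSup S).mkQ_surjective y
  exact (Submodule.Quotient.mk_eq_zero _).mpr (hle ((hr x).mpr hy))

theorem exists_directSum {ι : Type u} (M : ι → CocommCone R) :
    ∃ S : CocommCone R, ∀ i, ∃ f : (M i).carrier →ₗc[k] S.carrier,
      ∀ j, (S.π j).comp f = (M i).π j := by
  classical
  have key := fun j i => lsumCoalgHom_comp_lsingle (fun i => (M i).π j) i
  refine ⟨{ carrier := Π₀ i, (M i).carrier
            π := fun j => lsumCoalgHom fun i => (M i).π j
            compat := ?_ }, fun i =>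
    ⟨lsingleCoalgHom (fun i => (M i).carrier) i, fun j => key j i⟩⟩
  intro i j f hf
  refine DFinsupp.lhom_ext' fun a => LinearMap.ext fun x => ?_
  exact (congrArg f (CoalgHom.congr_fun (key i a) x)).trans
    ((LinearMap.congr_fun ((M a).compat i j f hf) x).trans
      (CoalgHom.congr_fun (key j a) x).symm)

theorem exists_sum (M N : CocommCone R) :
    ∃ (S : CocommCone R) (f : M.carrier →ₗc[k] S.carrier) (g : N.carrier →ₗc[k] S.carrier),
      (∀ j, (S.π j).comp f = M.π j) ∧ ∀ j, (S.π j).comp g = N.π j := by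
  obtain ⟨S, hS⟩ := exists_directSum fun b : ULift.{u} Bool => cond b.down M N
  obtain ⟨f, hf⟩ := hS ⟨true⟩
  obtain ⟨g, hg⟩ := hS ⟨false⟩
  exact ⟨S, f, g, hf, hg⟩

end CocommCone

end Cones

section Terminal

universe v

variable {k}
variable {J : Type v} {A : J → Type u} [∀ j, AddCommGroup (A j)] [∀ j, Module k (A j)]
  [∀ j, Coalgebra k (A j)]

/-- A cone whose apex is carried by a quotient of the space of finitely supported sequences. -/
structure CountableCone (R : ∀ i j, Set (A i →ₗ[k] A j)) where
  /-- the relations defining the apex -/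
  rel : Submodule k (ℕ →₀ k)
  [isCoalgebra : Coalgebra k ((ℕ →₀ k) ⧸ rel)]
  [isCocomm : Coalgebra.IsCocomm k ((ℕ →₀ k) ⧸ rel)]
  /-- the legs of the cone -/
  π : ∀ j, ((ℕ →₀ k) ⧸ rel) →ₗc[k] A j
  compat : ∀ i j, ∀ f ∈ R i j,
    f ∘ₗ (π i : ((ℕ →₀ k) ⧸ rel) →ₗ[k] A i) = (π j : ((ℕ →₀ k) ⧸ rel) →ₗ[k] A j)

attribute [instance] CountableCone.isCoalgebra CountableCone.isCocomm

namespace CocommCone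

variable {R : ∀ i j, Set (A i →ₗ[k] A j)}

/-- The cone underlying a countable cone. -/
noncomputable def ofCountable (C : CountableCone R) : CocommCone R where
  carrier := (ℕ →₀ k) ⧸ C.rel
  π := C.π
  compat := C.compat

/-- Every element of a cone lies in the image of a countable cone. -/
theorem exists_ofCountable (C : CocommCone R) (c : C.carrier) :
    ∃ (Q : CountableCone R) (i : (ofCountable Q).carrier →ₗc[k] C.carrier),
      (∀ j, (C.π j).comp i = (ofCountable Q).π j) ∧ ∃ q, i q = c := by
  obtain ⟨g, ⟨y, hy⟩, hg⟩ := exists_countable_comul_stable (k := k) c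
  have hinj : Function.Injective ((ker g).liftQ g le_rfl) :=
    ker_eq_bot.mp (Submodule.ker_liftQ_eq_bot _ _ _ le_rfl)
  obtain ⟨_, _, i, hi⟩ := exists_coalgebra_of_injective ((ker g).liftQ g le_rfl) hinj (by
    intro q
    obtain ⟨x, rfl⟩ := (ker g).mkQ_surjective q
    obtain ⟨t, ht⟩ := hg _ ⟨x, rfl⟩
    refine ⟨TensorProduct.map (ker g).mkQ (ker g).mkQ t, ?_⟩
    rw [← LinearMap.comp_apply, ← TensorProduct.map_comp, Submodule.liftQ_mkQ, ht]
    rfl)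
  refine ⟨{ rel := ker g, π := (C.precomp i).π, compat := (C.precomp i).compat }, i,
    fun j => rfl, (ker g).mkQ y, ?_⟩
  have := LinearMap.congr_fun hi ((ker g).mkQ y)
  exact this.trans hy

/-- A coalgebra map whose image lies in that of an injective coalgebra map factors through the
latter. -/
theorem exists_comp_eq_of_injective {C D E : Type u} [AddCommGroup C] [Module k C]
    [Coalgebra k C] [AddCommGroup D] [Module k D] [Coalgebra k D] [AddCommGroup E] [Module k E]
    [Coalgebra k E] (a : D →ₗc[k] E) (b : C →ₗc[k] E) (ha : Function.Injective a)
    (h : ∀ c, ∃ d, a d = b c) : ∃ f : C →ₗc[k] D, a.comp f = b := by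
  let f : C →ₗ[k] D := (LinearEquiv.ofInjective (a : D →ₗ[k] E) ha).symm.toLinearMap ∘ₗ
    (b : C →ₗ[k] E).codRestrict (range (a : D →ₗ[k] E)) h
  have hf : ∀ c, a (f c) = b c := fun c => congrArg Subtype.val
    ((LinearEquiv.ofInjective (a : D →ₗ[k] E) ha).apply_symm_apply
      ((b : C →ₗ[k] E).codRestrict (range (a : D →ₗ[k] E)) h c))
  have hf' : (a : D →ₗ[k] E) ∘ₗ f = b := LinearMap.ext hf
  refine ⟨{ f with
    counit_comp := by
      ext c
      have h1 := CoalgHomClass.counit_comp_apply a (f c)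
      have h2 := CoalgHomClass.counit_comp_apply b c
      rw [← hf, h1] at h2
      exact h2
    map_comp_comul := by
      ext c
      apply TensorProduct.map_injective_of_flat_flat (a : D →ₗ[k] E) (a : D →ₗ[k] E) ha ha
      have h1 := CoalgHomClass.map_comp_comul_apply a (f c)
      have h2 := CoalgHomClass.map_comp_comul_apply b c
      rw [LinearMap.comp_apply, LinearMap.comp_apply, ← LinearMap.comp_apply,
        ← TensorProduct.map_comp]
      erw [hf', h1, h2, hf] }, CoalgHom.coe_linearMap_injective hf'⟩

theorem exists_isTerminal {J : Type u} {A : J → Type u} [∀ j, AddCommGroup (A j)]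
    [∀ j, Module k (A j)] [∀ j, Coalgebra k (A j)] (R : ∀ i j, Set (A i →ₗ[k] A j)) :
    ∃ L : CocommCone R, L.IsTerminal := by
  obtain ⟨S, hS⟩ := exists_directSum fun Q : CountableCone R => ofCountable Q
  obtain ⟨L, r, hL, -, hr⟩ := S.exists_reduced
  refine ⟨L, fun C => ?_⟩
  obtain ⟨N, a₀, b₀, ha₀, hb₀⟩ := exists_sum L C
  obtain ⟨M, q, hM, -, hq⟩ := N.exists_reduced
  obtain ⟨a, ha_def⟩ : ∃ a, a = q.comp a₀ := ⟨_, rfl⟩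
  obtain ⟨b, hb_def⟩ : ∃ b, b = q.comp b₀ := ⟨_, rfl⟩
  have ha : ∀ j, (M.π j).comp a = L.π j := fun j => by
    rw [ha_def, ← CoalgHom.comp_assoc, hq, ha₀]
  have hb : ∀ j, (M.π j).comp b = C.π j := fun j => by
    rw [hb_def, ← CoalgHom.comp_assoc, hq, hb₀]
  have hinj : Function.Injective a := by
    refine ker_eq_bot.mp (hL _ (isCoideal_ker a) fun j x hx => ?_)
    have hx' : a x = 0 := hx
    rw [← ha]
    simp [hx']
  obtain ⟨f, hf⟩ := exists_comp_eq_of_injective a b hinj fun c => by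
    obtain ⟨Q, i, hi, y, rfl⟩ := C.exists_ofCountable c
    obtain ⟨s, hs⟩ := hS Q
    have : b.comp i = a.comp (r.comp s) := hM.hom_ext fun j => by
      rw [← CoalgHom.comp_assoc, ← CoalgHom.comp_assoc, hb, ha, hi, ← CoalgHom.comp_assoc, hr, hs]
    exact ⟨r (s y), (CoalgHom.congr_fun this y).symm⟩
  have hfπ : ∀ j, (L.π j).comp f = C.π j := fun j => by
    rw [← ha, CoalgHom.comp_assoc, hf, hb]
  exact ⟨f, hfπ, fun g hg => hL.hom_ext fun j => (hg j).trans (hfπ j).symm⟩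

end CocommCone

end Terminal

section TensorTensorTensorComm

variable {k}
variable (A B C D : Type u) [AddCommGroup A] [Module k A] [Coalgebra k A]
  [AddCommGroup B] [Module k B] [Coalgebra k B] [AddCommGroup C] [Module k C] [Coalgebra k C]
  [AddCommGroup D] [Module k D] [Coalgebra k D]

/-- `TensorProduct.tensorTensorTensorComm` as a coalgebra map. -/
noncomputable def tensorTensorTensorCommHom :
    (A ⊗[k] B) ⊗[k] (C ⊗[k] D) →ₗc[k] (A ⊗[k] C) ⊗[k] (B ⊗[k] D) where
  toLinearMap := (TensorProduct.tensorTensorTensorComm k A B C D).toLinearMap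
  counit_comp := by
    ext a b c d
    simp [mul_mul_mul_comm]
  map_comp_comul := by
    ext a b c d
    simp only [TensorProduct.AlgebraTensorModule.curry_apply, restrictScalars_self, curry_apply,
      LinearMap.comp_apply, TensorProduct.comul_tmul, LinearEquiv.coe_coe,
      TensorProduct.tensorTensorTensorComm_tmul, TensorProduct.curry_apply]
    hopf_tensor_induction Coalgebra.comul (R := k) a with a₁ a₂
    hopf_tensor_induction Coalgebra.comul (R := k) b with b₁ b₂
    hopf_tensor_induction Coalgebra.comul (R := k) c with c₁ c₂
    hopf_tensor_induction Coalgebra.comul (R := k) d with d₁ d₂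
    simp

end TensorTensorTensorComm

namespace HopfStr

variable {k}
variable {V : Type u} [AddCommGroup V] [Module k V] [Coalgebra k V]

/-- The multiplication as a coalgebra map. -/
noncomputable def mulHom (h : HopfStr k V) : V ⊗[k] V →ₗc[k] V where
  toLinearMap := h.mul
  counit_comp := by
    ext a b
    simp [h.counit_mul, mul_comm]
  map_comp_comul := by
    ext a b
    exact (h.comul_mul a b).symm

/-- The unit as a coalgebra map. -/
noncomputable def oneHom (h : HopfStr k V) : k →ₗc[k] V where
  toLinearMap := toSpanSingleton k V h.one
  counit_comp := by
    ext
    simp [h.counit_one]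
  map_comp_comul := by
    ext
    simp [h.comul_one]

@[simp]
theorem mulHom_apply (h : HopfStr k V) (x : V ⊗[k] V) : h.mulHom x = h.mul x := rfl

@[simp]
theorem oneHom_apply (h : HopfStr k V) (c : k) : h.oneHom c = c • h.one := rfl

/-- The map `x ⊗ y ↦ x₍₁₎ ⊗ g(x₍₂₎)y`. -/
noncomputable def shear (h : HopfStr k V) (g : V →ₗ[k] V) : V ⊗[k] V →ₗ[k] V ⊗[k] V :=
  lTensor V (h.mul ∘ₗ rTensor V g) ∘ₗ (TensorProduct.assoc k V V V).toLinearMap ∘ₗ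
    rTensor V Coalgebra.comul

theorem shear_tmul (h : HopfStr k V) (g : V →ₗ[k] V) (x y : V) :
    h.shear g (x ⊗ₜ y) =
      lTensor V (h.mul ∘ₗ (TensorProduct.mk k V V).flip y ∘ₗ g) (Coalgebra.comul x) := by
  have : ∀ t : V ⊗[k] V, lTensor V (h.mul ∘ₗ rTensor V g) (TensorProduct.assoc k V V V (t ⊗ₜ y)) =
      lTensor V (h.mul ∘ₗ (TensorProduct.mk k V V).flip y ∘ₗ g) t := fun t => by
    induction t with
    | zero => simp
    | add a b ha hb => simp only [TensorProduct.add_tmul, map_add, ha, hb]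
    | tmul a b => simp
  exact this _

theorem shear_shear (h : HopfStr k V) (f g : V →ₗ[k] V) (t : V ⊗[k] V) :
    h.shear f (h.shear g t) = h.shear (h.mul ∘ₗ TensorProduct.map f g ∘ₗ Coalgebra.comul) t := by
  induction t with
  | zero => simp
  | add a b ha hb => simp only [map_add, ha, hb]
  | tmul x y =>
    set N : V →ₗ[k] V := h.mul ∘ₗ (TensorProduct.mk k V V).flip y ∘ₗ g
    have h1 : h.shear f ∘ₗ lTensor V N = lTensor V (h.mul ∘ₗ TensorProduct.map f N) ∘ₗ
        (TensorProduct.assoc k V V V).toLinearMap ∘ₗ rTensor V Coalgebra.comul := by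
      ext p q
      simp only [TensorProduct.AlgebraTensorModule.curry_apply, restrictScalars_self,
        TensorProduct.curry_apply, LinearMap.comp_apply, lTensor_tmul, rTensor_tmul, shear_tmul,
        LinearEquiv.coe_coe]
      hopf_tensor_induction Coalgebra.comul (R := k) p with p₁ p₂
      simp
    have h2 : h.mul ∘ₗ TensorProduct.map f N = h.mul ∘ₗ (TensorProduct.mk k V V).flip y ∘ₗ
        h.mul ∘ₗ TensorProduct.map f g := by
      ext p q
      simp [N, h.mul_assoc]
    have h3 := LinearMap.congr_fun h1 (Coalgebra.comul x)
    simp only [LinearMap.comp_apply, LinearEquiv.coe_coe, Coalgebra.coassoc_apply] at h3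
    rw [shear_tmul, shear_tmul, h3, h2, ← lTensor_comp_apply]
    rfl

theorem shear_one (h : HopfStr k V) :
    h.shear (toSpanSingleton k V h.one ∘ₗ Coalgebra.counit) = LinearMap.id := by
  ext x y
  have : h.mul ∘ₗ (TensorProduct.mk k V V).flip y ∘ₗ toSpanSingleton k V h.one =
      toSpanSingleton k V y := by
    ext
    simp [h.one_mul]
  simp only [TensorProduct.AlgebraTensorModule.curry_apply, restrictScalars_self,
    TensorProduct.curry_apply, shear_tmul, LinearMap.id_apply]
  rw [← LinearMap.comp_assoc, ← LinearMap.comp_assoc, LinearMap.comp_assoc _ _ h.mul, this,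
    lTensor_comp_apply, Coalgebra.lTensor_counit_comul]
  simp

theorem shear_id_antipode (h : HopfStr k V) (t : V ⊗[k] V) :
    h.shear LinearMap.id (h.shear h.antipode t) = t := by
  rw [shear_shear]
  exact (congrArg (fun g => h.shear g t) h.antipode_right).trans
    (LinearMap.congr_fun h.shear_one t)

theorem shear_antipode_id (h : HopfStr k V) (t : V ⊗[k] V) :
    h.shear h.antipode (h.shear LinearMap.id t) = t := by
  rw [shear_shear]
  exact (congrArg (fun g => h.shear g t) h.antipode_left).trans
    (LinearMap.congr_fun h.shear_one t)

theorem lid_rTensor_counit_shear (h : HopfStr k V) (g : V →ₗ[k] V) (x : V) :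
    TensorProduct.lid k V (rTensor V Coalgebra.counit (h.shear g (x ⊗ₜ h.one))) = g x := by
  have : h.mul ∘ₗ (TensorProduct.mk k V V).flip h.one ∘ₗ g = g := by
    ext x
    simp [h.mul_one]
  rw [shear_tmul, this, ← LinearMap.comp_apply, rTensor_comp_lTensor, ← lTensor_comp_rTensor,
    LinearMap.comp_apply, Coalgebra.rTensor_counit_comul]
  simp

/-- A coalgebra map preserving multiplication and unit preserves antipodes. -/
theorem map_antipode {W : Type u} [AddCommGroup W] [Module k W] [Coalgebra k W]
    (hV : HopfStr k V) (hW : HopfStr k W) (f : V →ₗc[k] W)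
    (hmul : ∀ a b, f (hV.mul (a ⊗ₜ b)) = hW.mul (f a ⊗ₜ f b)) (hone : f hV.one = hW.one) (x : V) :
    f (hV.antipode x) = hW.antipode (f x) := by
  set F : V ⊗[k] V →ₗ[k] W ⊗[k] W := TensorProduct.map (f : V →ₗ[k] W) (f : V →ₗ[k] W)
  have h1 : F ∘ₗ hV.shear LinearMap.id = hW.shear LinearMap.id ∘ₗ F := by
    ext x y
    simp only [TensorProduct.AlgebraTensorModule.curry_apply, restrictScalars_self,
      TensorProduct.curry_apply, LinearMap.comp_apply, F, TensorProduct.map_tmul, shear_tmul]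
    have := CoalgHomClass.map_comp_comul_apply f x
    erw [← this]
    hopf_tensor_induction Coalgebra.comul (R := k) x with x₁ x₂
    simp [hmul]
  have h2 : F (hV.shear hV.antipode (x ⊗ₜ hV.one)) = hW.shear hW.antipode (f x ⊗ₜ hW.one) := by
    have := LinearMap.congr_fun h1 (hV.shear hV.antipode (x ⊗ₜ hV.one))
    rw [LinearMap.comp_apply, LinearMap.comp_apply, shear_id_antipode] at this
    rw [← hW.shear_antipode_id (F _), ← this]
    simp [F, hone]
  have h3 : ∀ t, TensorProduct.lid k W (rTensor W Coalgebra.counit (F t)) =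
      f (TensorProduct.lid k V (rTensor V Coalgebra.counit t)) := fun t => by
    induction t with
    | zero => simp
    | add a b ha hb => simp only [map_add, ha, hb]
    | tmul a b => simp [F]
  rw [← lid_rTensor_counit_shear hV, ← h3, h2, lid_rTensor_counit_shear]

variable [Coalgebra.IsCocomm k V]

/-- The map `x ⊗ y ↦ x₍₁₎ ⊗ x₍₂₎y` as a coalgebra map. -/
noncomputable def shearHom (h : HopfStr k V) : V ⊗[k] V →ₗc[k] V ⊗[k] V :=
  (Coalgebra.TensorProduct.map (CoalgHom.id k V) h.mulHom).comp
    ((Coalgebra.TensorProduct.assoc k k V V V).toCoalgHom.comp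
      (Coalgebra.TensorProduct.map (Coalgebra.comulCoalgHom k V) (CoalgHom.id k V)))

theorem shearHom_apply (h : HopfStr k V) (t : V ⊗[k] V) : h.shearHom t = h.shear LinearMap.id t := by
  simp only [shear, rTensor_id, LinearMap.comp_id]
  rfl

theorem shearHom_bijective (h : HopfStr k V) : Function.Bijective h.shearHom :=
  Function.bijective_iff_has_inverse.mpr ⟨h.shear h.antipode,
    fun t => by rw [shearHom_apply, shear_antipode_id],
    fun t => by rw [shearHom_apply, shear_id_antipode]⟩

/-- The antipode of a cocommutative Hopf algebra is a coalgebra map. -/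
theorem exists_antipodeHom (h : HopfStr k V) :
    ∃ S : V →ₗc[k] V, (S : V →ₗ[k] V) = h.antipode := by
  let e := CoalgEquiv.ofBijective h.shearHom_bijective
  refine ⟨(Coalgebra.TensorProduct.lid k V).toCoalgHom.comp
    ((Coalgebra.TensorProduct.map (Coalgebra.counitCoalgHom k V) (CoalgHom.id k V)).comp
      (e.symm.toCoalgHom.comp ((Coalgebra.TensorProduct.map (CoalgHom.id k V) h.oneHom).comp
        (Coalgebra.TensorProduct.rid k k V).symm.toCoalgHom))), ?_⟩
  ext x
  have : e.symm (x ⊗ₜ h.one) = h.shear h.antipode (x ⊗ₜ h.one) := by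
    apply h.shearHom_bijective.injective
    refine (CoalgEquiv.apply_symm_apply e _).trans ?_
    exact ((h.shearHom_apply _).trans (h.shear_id_antipode _)).symm
  refine Eq.trans ?_ (lid_rTensor_counit_shear h h.antipode x)
  rw [← this]
  have h1 : (1 : k) • h.one = h.one := one_smul _ _
  conv_rhs => rw [← h1]
  rfl

end HopfStr

section Lifting

universe v

variable {k}

/-- A linear map preserving multiplications, units and antipodes. -/
structure HopfStr.IsHom {V W : Type u} [AddCommGroup V] [Module k V] [Coalgebra k V]
    [AddCommGroup W] [Module k W] [Coalgebra k W] (hV : HopfStr k V) (hW : HopfStr k W)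
    (f : V →ₗ[k] W) : Prop where
  map_mul : ∀ x y, f (hV.mul (x ⊗ₜ y)) = hW.mul (f x ⊗ₜ f y)
  map_one : f hV.one = hW.one
  map_antipode : ∀ x, f (hV.antipode x) = hW.antipode (f x)

namespace IsHopfBraceHom

variable {V W : Type u} [AddCommGroup V] [Module k V] [Coalgebra k V]
  [AddCommGroup W] [Module k W] [Coalgebra k W] {BV : HopfBrace k V} {BW : HopfBrace k W}
  {f : V →ₗ[k] W}

/-- The coalgebra map underlying a morphism of Hopf braces. -/
def toCoalgHom (hf : IsHopfBraceHom BV BW f) : V →ₗc[k] W where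
  toLinearMap := f
  counit_comp := LinearMap.ext hf.counit_comp
  map_comp_comul := LinearMap.ext fun a => (hf.comul_comp a).symm

theorem isHom_dot (hf : IsHopfBraceHom BV BW f) : BV.dot.IsHom BW.dot f :=
  ⟨hf.map_mul, hf.map_one, BV.dot.map_antipode BW.dot hf.toCoalgHom hf.map_mul hf.map_one⟩

theorem isHom_circ (hf : IsHopfBraceHom BV BW f) : BV.circ.IsHom BW.circ f :=
  ⟨hf.map_cmul, hf.map_cone, BV.circ.map_antipode BW.circ hf.toCoalgHom hf.map_cmul hf.map_cone⟩

end IsHopfBraceHom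

theorem exists_braceRHSHom {V : Type u} [AddCommGroup V] [Module k V] [Coalgebra k V]
    [Coalgebra.IsCocomm k V] (h h' : HopfStr k V) :
    ∃ f : V ⊗[k] (V ⊗[k] V) →ₗc[k] V,
      (f : V ⊗[k] (V ⊗[k] V) →ₗ[k] V) = braceRHS h.mul h.antipode h'.mul := by
  obtain ⟨S, hS⟩ := h.exists_antipodeHom
  refine ⟨h.mulHom.comp ((Coalgebra.TensorProduct.map (CoalgHom.id k V) h.mulHom).comp
    ((Coalgebra.TensorProduct.map h'.mulHom (Coalgebra.TensorProduct.map S h'.mulHom)).comp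
    ((Coalgebra.TensorProduct.map (CoalgHom.id k (V ⊗[k] V))
      (Coalgebra.TensorProduct.assoc k k V V V).toCoalgHom).comp
    ((tensorTensorTensorCommHom V (V ⊗[k] V) V V).comp
    (Coalgebra.TensorProduct.map ((Coalgebra.TensorProduct.map (CoalgHom.id k V)
      (Coalgebra.comulCoalgHom k V)).comp (Coalgebra.comulCoalgHom k V))
      (CoalgHom.id k (V ⊗[k] V))))))), ?_⟩
  rw [braceRHS, ← hS]
  rfl

theorem braceRHS_naturality {V W : Type u} [AddCommGroup V] [Module k V] [Coalgebra k V]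
    [AddCommGroup W] [Module k W] [Coalgebra k W] {hV hV' : HopfStr k V} {hW hW' : HopfStr k W}
    (f : V →ₗc[k] W) (hf : hV.IsHom hW (f : V →ₗ[k] W)) (hf' : hV'.IsHom hW' (f : V →ₗ[k] W))
    (x y z : V) :
    f (braceRHS hV.mul hV.antipode hV'.mul (x ⊗ₜ (y ⊗ₜ z))) =
      braceRHS hW.mul hW.antipode hW'.mul (f x ⊗ₜ (f y ⊗ₜ f z)) := by
  have h1 := hf.map_mul
  have h2 := hf.map_antipode
  have h3 := hf'.map_mul
  simp only [CoalgHom.coe_toLinearMap] at h1 h2 h3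
  have hΔ := fun x => (CoalgHomClass.map_comp_comul_apply f x).symm
  simp only [braceRHS, LinearMap.comp_apply, rTensor_tmul, hΔ]
  induction Coalgebra.comul (R := k) x with
  | zero => simp
  | add a b ha hb => simp only [map_add, TensorProduct.add_tmul, ha, hb]
  | tmul x₁ x₂ =>
    simp only [TensorProduct.map_tmul, lTensor_tmul, CoalgHom.coe_toLinearMap, hΔ]
    induction Coalgebra.comul (R := k) x₂ with
    | zero => simp
    | add a b ha hb =>
      simp only [map_add, TensorProduct.add_tmul, TensorProduct.tmul_add, ha, hb]
    | tmul x₃ x₄ => simp [h1, h2, h3]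

variable {J : Type v} {A : J → Type u} [∀ j, AddCommGroup (A j)] [∀ j, Module k (A j)]
  [∀ j, Coalgebra k (A j)] {R : ∀ i j, Set (A i →ₗ[k] A j)}

namespace CocommCone.IsTerminal

variable {L : CocommCone R}

theorem hom_ext (hL : L.IsTerminal) {C : Type u} [AddCommGroup C] [Module k C]
    [Coalgebra k C] [Coalgebra.IsCocomm k C] {f g : C →ₗc[k] L.carrier}
    (h : ∀ j, (L.π j).comp f = (L.π j).comp g) : f = g :=
  (hL (L.precomp g)).unique h fun _ => rfl

/-- Compatible families of Hopf algebra structures lift to the apex of a terminal cone. -/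
theorem exists_hopfStr (hL : L.IsTerminal) [∀ j, Coalgebra.IsCocomm k (A j)]
    (h : ∀ j, HopfStr k (A j))
    (hR : ∀ i j, ∀ f ∈ R i j, (h i).IsHom (h j) f) :
    ∃ H : HopfStr k L.carrier, ∀ j, H.IsHom (h j) (L.π j : L.carrier →ₗ[k] A j) := by
  choose S hS using fun j => (h j).exists_antipodeHom
  have hS' : ∀ j x, S j x = (h j).antipode x := fun j x => LinearMap.congr_fun (hS j) x
  have hRπ : ∀ i j, ∀ f ∈ R i j, ∀ x, f (L.π i x) = L.π j x := fun i j f hf x =>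
    LinearMap.congr_fun (L.compat i j f hf) x
  obtain ⟨m, hm, -⟩ := hL
    { carrier := L.carrier ⊗[k] L.carrier
      π := fun j => (h j).mulHom.comp (Coalgebra.TensorProduct.map (L.π j) (L.π j))
      compat := fun i j f hf => by
        ext x y
        simp [(hR i j f hf).map_mul, hRπ i j f hf] }
  obtain ⟨u, hu, -⟩ := hL
    { carrier := k
      π := fun j => (h j).oneHom
      compat := fun i j f hf => by
        ext
        simp [(hR i j f hf).map_one] }
  obtain ⟨T, hT, -⟩ := hL
    { carrier := L.carrier
      π := fun j => (S j).comp (L.π j)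
      compat := fun i j f hf => by
        ext x
        simp [hS', (hR i j f hf).map_antipode, hRπ i j f hf] }
  have hm' : ∀ j x y, L.π j (m (x ⊗ₜ y)) = (h j).mul (L.π j x ⊗ₜ L.π j y) :=
    fun j x y => CoalgHom.congr_fun (hm j) (x ⊗ₜ y)
  have hu' : ∀ j, L.π j (u 1) = (h j).one :=
    fun j => (CoalgHom.congr_fun (hu j) 1).trans (one_smul _ _)
  have hT' : ∀ j x, L.π j (T x) = (h j).antipode (L.π j x) :=
    fun j x => (CoalgHom.congr_fun (hT j) x).trans (hS' j _)
  have hassoc : m.comp (Coalgebra.TensorProduct.map m (CoalgHom.id k L.carrier)) =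
      m.comp ((Coalgebra.TensorProduct.map (CoalgHom.id k L.carrier) m).comp
        (Coalgebra.TensorProduct.assoc k k L.carrier L.carrier L.carrier).toCoalgHom) :=
    hL.hom_ext fun j => CoalgHom.coe_linearMap_injective (by
      ext x y z
      simp [hm', (h j).mul_assoc])
  have hone_mul : m.comp ((Coalgebra.TensorProduct.map u (CoalgHom.id k L.carrier)).comp
      (Coalgebra.TensorProduct.lid k L.carrier).symm.toCoalgHom) = CoalgHom.id k L.carrier :=
    hL.hom_ext fun j => by
      ext x
      simp [hm', hu', (h j).one_mul]
  have hmul_one : m.comp ((Coalgebra.TensorProduct.map (CoalgHom.id k L.carrier) u).comp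
      (Coalgebra.TensorProduct.rid k k L.carrier).symm.toCoalgHom) = CoalgHom.id k L.carrier :=
    hL.hom_ext fun j => by
      ext x
      simp [hm', hu', (h j).mul_one]
  have hleft : m.comp ((Coalgebra.TensorProduct.map T (CoalgHom.id k L.carrier)).comp
      (Coalgebra.comulCoalgHom k L.carrier)) = u.comp (Coalgebra.counitCoalgHom k L.carrier) :=
    hL.hom_ext fun j => by
      ext x
      have key : ∀ t, L.π j (m (TensorProduct.map (T : L.carrier →ₗ[k] L.carrier) .id t)) =
          (h j).mul (rTensor (A j) (h j).antipode
            (TensorProduct.map (L.π j : L.carrier →ₗ[k] A j) (L.π j) t)) := fun t => by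
        induction t with
        | zero => simp
        | add a b ha hb => simp only [map_add, ha, hb]
        | tmul a b => simp [hm', hT']
      have h1 := CoalgHomClass.map_comp_comul_apply (L.π j) x
      have h2 := LinearMap.congr_fun (h j).antipode_left (L.π j x)
      have h3 : ∀ c : k, L.π j (u c) = c • (h j).one := CoalgHom.congr_fun (hu j)
      have h4 := CoalgHomClass.counit_comp_apply (L.π j) x
      refine (key (Coalgebra.comul x)).trans ?_
      refine Eq.trans ?_ (h3 (Coalgebra.counit x)).symm
      erw [h1, ← h4]
      exact h2
  have hright : m.comp ((Coalgebra.TensorProduct.map (CoalgHom.id k L.carrier) T).comp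
      (Coalgebra.comulCoalgHom k L.carrier)) = u.comp (Coalgebra.counitCoalgHom k L.carrier) :=
    hL.hom_ext fun j => by
      ext x
      have key : ∀ t, L.π j (m (TensorProduct.map .id (T : L.carrier →ₗ[k] L.carrier) t)) =
          (h j).mul (lTensor (A j) (h j).antipode
            (TensorProduct.map (L.π j : L.carrier →ₗ[k] A j) (L.π j) t)) := fun t => by
        induction t with
        | zero => simp
        | add a b ha hb => simp only [map_add, ha, hb]
        | tmul a b => simp [hm', hT']
      have h1 := CoalgHomClass.map_comp_comul_apply (L.π j) x
      have h2 := LinearMap.congr_fun (h j).antipode_right (L.π j x)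
      have h3 : ∀ c : k, L.π j (u c) = c • (h j).one := CoalgHom.congr_fun (hu j)
      have h4 := CoalgHomClass.counit_comp_apply (L.π j) x
      refine (key (Coalgebra.comul x)).trans ?_
      refine Eq.trans ?_ (h3 (Coalgebra.counit x)).symm
      erw [h1, ← h4]
      exact h2
  have hspan : toSpanSingleton k L.carrier (u 1) = (u : k →ₗ[k] L.carrier) := by
    ext
    simp
  refine ⟨{
    mul := m
    one := u 1
    mul_assoc := fun a b c => CoalgHom.congr_fun hassoc ((a ⊗ₜ b) ⊗ₜ c)
    one_mul := fun a => CoalgHom.congr_fun hone_mul a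
    mul_one := fun a => CoalgHom.congr_fun hmul_one a
    comul_mul := fun a b => (CoalgHomClass.map_comp_comul_apply m (a ⊗ₜ b)).symm
    counit_mul := fun a b => (CoalgHomClass.counit_comp_apply m (a ⊗ₜ b)).trans (mul_comm _ _)
    comul_one := (CoalgHomClass.map_comp_comul_apply u 1).symm
    counit_one := CoalgHomClass.counit_comp_apply u 1
    antipode := T
    antipode_left := (congrArg CoalgHom.toLinearMap hleft).trans (hspan ▸ rfl)
    antipode_right := (congrArg CoalgHom.toLinearMap hright).trans (hspan ▸ rfl) },
    fun j => ⟨hm' j, hu' j, hT' j⟩⟩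

/-- Compatible families of Hopf braces lift to the apex of a terminal cone. -/
theorem exists_hopfBrace (hL : L.IsTerminal) [∀ j, Coalgebra.IsCocomm k (A j)]
    (B : ∀ j, HopfBrace k (A j))
    (hR : ∀ i j, ∀ f ∈ R i j, IsHopfBraceHom (B i) (B j) f) :
    ∃ H : HopfBrace k L.carrier,
      ∀ j, H.dot.IsHom (B j).dot (L.π j : L.carrier →ₗ[k] A j) ∧
        H.circ.IsHom (B j).circ (L.π j : L.carrier →ₗ[k] A j) := by
  obtain ⟨d, hd⟩ := hL.exists_hopfStr (fun j => (B j).dot) fun i j f hf => (hR i j f hf).isHom_dot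
  obtain ⟨c, hc⟩ := hL.exists_hopfStr (fun j => (B j).circ)
    fun i j f hf => (hR i j f hf).isHom_circ
  obtain ⟨F, hF⟩ := exists_braceRHSHom d c
  have key : c.mulHom.comp (Coalgebra.TensorProduct.map (CoalgHom.id k L.carrier) d.mulHom) = F :=
    hL.hom_ext fun j => CoalgHom.coe_linearMap_injective (by
      ext x y z
      have h1 := (congrArg (L.π j) (LinearMap.congr_fun hF (x ⊗ₜ (y ⊗ₜ z)))).trans
        (braceRHS_naturality (L.π j) (hd j) (hc j) x y z)
      have h2 := LinearMap.congr_fun (B j).brace (L.π j x ⊗ₜ (L.π j y ⊗ₜ L.π j z))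
      refine Eq.trans ?_ (h2.trans h1.symm)
      exact ((hc j).map_mul x (d.mul (y ⊗ₜ z))).trans
        (congrArg (fun t => (B j).circ.mul (L.π j x ⊗ₜ t)) ((hd j).map_mul y z)))
  exact ⟨⟨d, c, (congrArg CoalgHom.toLinearMap key).trans hF⟩, fun j => ⟨hd j, hc j⟩⟩

/-- A coalgebra map into the apex is a morphism of Hopf braces if its components are. -/
theorem isHopfBraceHom_of_comp (hL : L.IsTerminal) {B : ∀ j, HopfBrace k (A j)}
    {H : HopfBrace k L.carrier}
    (hH : ∀ j, IsHopfBraceHom H (B j) (L.π j : L.carrier →ₗ[k] A j)) {C : Type u}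
    [AddCommGroup C] [Module k C] [Coalgebra k C] [Coalgebra.IsCocomm k C] {BC : HopfBrace k C}
    (f : C →ₗc[k] L.carrier)
    (hf : ∀ j, IsHopfBraceHom BC (B j) ((L.π j).comp f : C →ₗ[k] A j)) :
    IsHopfBraceHom BC H (f : C →ₗ[k] L.carrier) := by
  have hmul : f.comp BC.dot.mulHom = H.dot.mulHom.comp (Coalgebra.TensorProduct.map f f) :=
    hL.hom_ext fun j => CoalgHom.coe_linearMap_injective (by
      ext x y
      exact ((hf j).map_mul x y).trans ((hH j).map_mul _ _).symm)
  have hone : f.comp BC.dot.oneHom = H.dot.oneHom :=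
    hL.hom_ext fun j => CoalgHom.coe_linearMap_injective (by
      ext
      have := (hf j).map_one.trans (hH j).map_one.symm
      simpa using this)
  have hcmul : f.comp BC.circ.mulHom = H.circ.mulHom.comp (Coalgebra.TensorProduct.map f f) :=
    hL.hom_ext fun j => CoalgHom.coe_linearMap_injective (by
      ext x y
      exact ((hf j).map_cmul x y).trans ((hH j).map_cmul _ _).symm)
  have hcone : f.comp BC.circ.oneHom = H.circ.oneHom :=
    hL.hom_ext fun j => CoalgHom.coe_linearMap_injective (by
      ext
      have := (hf j).map_cone.trans (hH j).map_cone.symm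
      simpa using this)
  refine ⟨fun a => (CoalgHomClass.map_comp_comul_apply f a).symm,
    fun a => CoalgHomClass.counit_comp_apply f a,
    fun a b => CoalgHom.congr_fun hmul (a ⊗ₜ b), ?_,
    fun a b => CoalgHom.congr_fun hcmul (a ⊗ₜ b), ?_⟩
  · simpa using CoalgHom.congr_fun hone 1
  · simpa using CoalgHom.congr_fun hcone 1

end CocommCone.IsTerminal

end Lifting

theorem IsHopfBraceHom.of_isHom {k : Type u} [Field k] {V W : Type u} [AddCommGroup V] [Module k V]
    [Coalgebra k V] [AddCommGroup W] [Module k W] [Coalgebra k W] {BV : HopfBrace k V}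
    {BW : HopfBrace k W} (f : V →ₗc[k] W) (hd : BV.dot.IsHom BW.dot (f : V →ₗ[k] W))
    (hc : BV.circ.IsHom BW.circ (f : V →ₗ[k] W)) : IsHopfBraceHom BV BW (f : V →ₗ[k] W) where
  comul_comp a := (CoalgHomClass.map_comp_comul_apply f a).symm
  counit_comp a := CoalgHomClass.counit_comp_apply f a
  map_mul := hd.map_mul
  map_one := hd.map_one
  map_cmul := hc.map_mul
  map_cone := hc.map_one

section Complete

open CategoryTheory CategoryTheory.Limits

variable {k}

instance (X : CocommHopfBraceCat k) : Coalgebra.IsCocomm k X.carrier := ⟨X.cocomm⟩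

theorem CocommHopfBraceCat.hasLimits : HasLimits (CocommHopfBraceCat k) := by
  refine ⟨fun J _ => ⟨fun F => ?_⟩⟩
  obtain ⟨L, hL⟩ := CocommCone.exists_isTerminal (A := fun j => (F.obj j).carrier)
    fun i j => Set.range fun f : i ⟶ j => (F.map f).1
  obtain ⟨H, hH⟩ := hL.exists_hopfBrace (fun j => (F.obj j).brace) (by
    rintro i j _ ⟨f, rfl⟩
    exact (F.map f).2)
  have hπ := fun j => IsHopfBraceHom.of_isHom (L.π j) (hH j).1 (hH j).2
  let P : CocommHopfBraceCat k := ⟨L.carrier, H, L.isCocomm.comm_comp_comul⟩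
  let p : ∀ j, P ⟶ F.obj j := fun j => ⟨L.π j, hπ j⟩
  let c : Cone F :=
    { pt := P
      π := { app := p
             naturality := fun i j f => Subtype.ext (L.compat i j _ ⟨f, rfl⟩).symm } }
  have hc : ∀ s : Cone F, ∃ l : s.pt ⟶ c.pt, (∀ j, l ≫ c.π.app j = s.π.app j) ∧
      ∀ m : s.pt ⟶ c.pt, (∀ j, m ≫ c.π.app j = s.π.app j) → m = l := fun s => by
    let q : ∀ j, s.pt ⟶ F.obj j := s.π.app
    obtain ⟨f, hf, hf'⟩ := hL
      { carrier := s.pt.carrier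
        π := fun j => (q j).2.toCoalgHom
        compat := by
          rintro i j _ ⟨f, rfl⟩
          exact congrArg Subtype.val (s.w f) }
    refine ⟨⟨f, hL.isHopfBraceHom_of_comp hπ f fun j => ?_⟩, fun j => Subtype.ext ?_,
      fun m hm => Subtype.ext ?_⟩
    · rw [hf j]
      exact (q j).2
    · exact congrArg CoalgHom.toLinearMap (hf j)
    · refine congrArg CoalgHom.toLinearMap (hf' m.2.toCoalgHom fun j => ?_)
      exact CoalgHom.coe_linearMap_injective (congrArg Subtype.val (hm j))
  choose l hl hl' using hc
  exact ⟨⟨c, ⟨l, hl, hl'⟩⟩⟩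

section Product

variable (X Y : Type u) [AddCommGroup X] [Module k X] [Coalgebra k X]
  [AddCommGroup Y] [Module k Y] [Coalgebra k Y]

/-- The first projection of a tensor product as a coalgebra map. -/
noncomputable def projLHom : X ⊗[k] Y →ₗc[k] X :=
  (Coalgebra.TensorProduct.rid k k X).toCoalgHom.comp
    (Coalgebra.TensorProduct.map (CoalgHom.id k X) (Coalgebra.counitCoalgHom k Y))

/-- The second projection of a tensor product as a coalgebra map. -/
noncomputable def projRHom : X ⊗[k] Y →ₗc[k] Y :=
  (Coalgebra.TensorProduct.lid k Y).toCoalgHom.comp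
    (Coalgebra.TensorProduct.map (Coalgebra.counitCoalgHom k X) (CoalgHom.id k Y))

theorem map_projL_projR_comul (t : X ⊗[k] Y) :
    TensorProduct.map (projL k X Y) (projR k X Y) (Coalgebra.comul t) = t := by
  have key : ∀ (a : X ⊗[k] X) (b : Y ⊗[k] Y),
      TensorProduct.map (projL k X Y) (projR k X Y)
        (TensorProduct.tensorTensorTensorComm k X X Y Y (a ⊗ₜ b)) =
      TensorProduct.rid k X (lTensor X Coalgebra.counit a) ⊗ₜ
        TensorProduct.lid k Y (rTensor Y Coalgebra.counit b) := fun a b => by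
    induction a with
    | zero => simp
    | add a₁ a₂ h₁ h₂ => simp only [map_add, TensorProduct.add_tmul, h₁, h₂]
    | tmul a₁ a₂ =>
      induction b with
      | zero => simp
      | add b₁ b₂ h₁ h₂ => simp only [map_add, TensorProduct.tmul_add, h₁, h₂]
      | tmul b₁ b₂ =>
        simp only [projL, projR, TensorProduct.tensorTensorTensorComm_tmul,
          TensorProduct.map_tmul, LinearMap.comp_apply, LinearEquiv.coe_coe, lTensor_tmul,
          rTensor_tmul, TensorProduct.rid_tmul, TensorProduct.lid_tmul,
          TensorProduct.smul_tmul_smul, mul_comm]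
  induction t with
  | zero => simp
  | add a b ha hb => simp only [map_add, ha, hb]
  | tmul x y =>
    refine (key _ _).trans ?_
    simp

variable {X Y} {C : Type u} [AddCommGroup C] [Module k C] [Coalgebra k C]

theorem projL_map_comul (f : C →ₗ[k] X) (g : C →ₗc[k] Y) (c : C) :
    projL k X Y (TensorProduct.map f (g : C →ₗ[k] Y) (Coalgebra.comul c)) = f c := by
  have : projL k X Y ∘ₗ TensorProduct.map f (g : C →ₗ[k] Y) =
      f ∘ₗ (TensorProduct.rid k C).toLinearMap ∘ₗ lTensor C Coalgebra.counit := by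
    ext a b
    simp [projL]
  have h := LinearMap.congr_fun this (Coalgebra.comul c)
  simpa using h

theorem projR_map_comul (f : C →ₗc[k] X) (g : C →ₗ[k] Y) (c : C) :
    projR k X Y (TensorProduct.map (f : C →ₗ[k] X) g (Coalgebra.comul c)) = g c := by
  have : projR k X Y ∘ₗ TensorProduct.map (f : C →ₗ[k] X) g =
      g ∘ₗ (TensorProduct.lid k C).toLinearMap ∘ₗ rTensor C Coalgebra.counit := by
    ext a b
    simp [projR]
  have h := LinearMap.congr_fun this (Coalgebra.comul c)
  simpa using h

end Product

variable (X Y : CocommHopfBraceCat k)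

/-- The tensor product of two cocommutative coalgebras as a cone. -/
noncomputable def tensorCone : CocommCone (A := fun b : Bool => (cond b X Y).carrier)
    fun _ _ => (∅ : Set (_ →ₗ[k] _)) where
  carrier := X.carrier ⊗[k] Y.carrier
  π
    | true => projLHom X.carrier Y.carrier
    | false => projRHom X.carrier Y.carrier
  compat _ _ _ hf := hf.elim

theorem tensorCone_isTerminal : (tensorCone X Y).IsTerminal := by
  intro C
  let f : C.carrier →ₗc[k] X.carrier := C.π true
  let g : C.carrier →ₗc[k] Y.carrier := C.π false
  refine ⟨(Coalgebra.TensorProduct.map f g).comp (Coalgebra.comulCoalgHom k C.carrier), ?_,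
    fun h hh => ?_⟩
  · rintro (_ | _)
    · ext c
      exact projR_map_comul f (g : C.carrier →ₗ[k] Y.carrier) c
    · ext c
      exact projL_map_comul (f : C.carrier →ₗ[k] X.carrier) g c
  · let h' : C.carrier →ₗc[k] X.carrier ⊗[k] Y.carrier := h
    have hf : projL k X.carrier Y.carrier ∘ₗ (h' : _ →ₗ[k] X.carrier ⊗[k] Y.carrier) =
        (f : C.carrier →ₗ[k] X.carrier) := congrArg CoalgHom.toLinearMap (hh true)
    have hg : projR k X.carrier Y.carrier ∘ₗ (h' : _ →ₗ[k] X.carrier ⊗[k] Y.carrier) =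
        (g : C.carrier →ₗ[k] Y.carrier) := congrArg CoalgHom.toLinearMap (hh false)
    ext c
    have h1 := CoalgHomClass.map_comp_comul_apply h' c
    have h2 := map_projL_projR_comul X.carrier Y.carrier (h' c)
    rw [← h1, ← LinearMap.comp_apply, ← TensorProduct.map_comp] at h2
    erw [hf, hg] at h2
    exact h2.symm

theorem exists_tensor_brace :
    ∃ (BP : HopfBrace k (X.carrier ⊗[k] Y.carrier)),
      (BP.dot.IsHom X.brace.dot (projL k X.carrier Y.carrier) ∧
        BP.circ.IsHom X.brace.circ (projL k X.carrier Y.carrier)) ∧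
      (BP.dot.IsHom Y.brace.dot (projR k X.carrier Y.carrier) ∧
        BP.circ.IsHom Y.brace.circ (projR k X.carrier Y.carrier)) ∧
      ∀ (Z : CocommHopfBraceCat k) (f : Z ⟶ X) (g : Z ⟶ Y),
        ∃ h : Z.carrier →ₗ[k] X.carrier ⊗[k] Y.carrier, IsHopfBraceHom Z.brace BP h ∧
          projL k X.carrier Y.carrier ∘ₗ h = f.1 ∧ projR k X.carrier Y.carrier ∘ₗ h = g.1 ∧
          ∀ h', IsHopfBraceHom Z.brace BP h' → projL k X.carrier Y.carrier ∘ₗ h' = f.1 →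
            projR k X.carrier Y.carrier ∘ₗ h' = g.1 → h' = h := by
  have hL := tensorCone_isTerminal X Y
  obtain ⟨H, hH⟩ := hL.exists_hopfBrace (fun b => (cond b X Y).brace)
    fun _ _ _ hf => hf.elim
  have hπ := fun b => IsHopfBraceHom.of_isHom ((tensorCone X Y).π b) (hH b).1 (hH b).2
  refine ⟨H, hH true, hH false, fun Z f g => ?_⟩
  obtain ⟨h₀, hh, hh'⟩ := hL
    { carrier := Z.carrier
      π
        | true => f.2.toCoalgHom
        | false => g.2.toCoalgHom
      compat := fun _ _ _ hf => hf.elim }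
  let h : Z.carrier →ₗc[k] X.carrier ⊗[k] Y.carrier := h₀
  refine ⟨(h : Z.carrier →ₗ[k] X.carrier ⊗[k] Y.carrier),
    hL.isHopfBraceHom_of_comp hπ h₀ ?_, congrArg CoalgHom.toLinearMap (hh true),
    congrArg CoalgHom.toLinearMap (hh false), fun h' hb h1 h2 => ?_⟩
  · rintro (_ | _)
    · exact hh false ▸ g.2
    · exact hh true ▸ f.2
  · refine congrArg CoalgHom.toLinearMap (hh' hb.toCoalgHom ?_)
    rintro (_ | _)
    · exact CoalgHom.coe_linearMap_injective h2
    · exact CoalgHom.coe_linearMap_injective h1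

end Complete

/-- The category of cocommutative Hopf braces over a field `k` is complete.
In particular, the product of a (finite) family of two cocommutative Hopf braces is the tensor
product of the underlying coalgebras, with the Hopf brace structure obtained by transporting
each multiplication, unit and antipode componentwise through the coalgebra projections. -/
theorem statement19 {k : Type u} [Field k] :
    CategoryTheory.Limits.HasLimits (CocommHopfBraceCat k) ∧
    ∀ X Y : CocommHopfBraceCat k,
      ∃ (BP : HopfBrace k (X.carrier ⊗[k] Y.carrier))
        (hcc : IsCocomm k (X.carrier ⊗[k] Y.carrier)),
        -- the structure is transported componentwise through the coalgebra projections
        (projL k X.carrier Y.carrier ∘ₗ BP.dot.mul = X.brace.dot.mul ∘ₗ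
          TensorProduct.map (projL k X.carrier Y.carrier) (projL k X.carrier Y.carrier)) ∧
        (projL k X.carrier Y.carrier BP.dot.one = X.brace.dot.one) ∧
        (projL k X.carrier Y.carrier ∘ₗ BP.dot.antipode =
          X.brace.dot.antipode ∘ₗ projL k X.carrier Y.carrier) ∧
        (projL k X.carrier Y.carrier ∘ₗ BP.circ.mul = X.brace.circ.mul ∘ₗ
          TensorProduct.map (projL k X.carrier Y.carrier) (projL k X.carrier Y.carrier)) ∧
        (projL k X.carrier Y.carrier BP.circ.one = X.brace.circ.one) ∧
        (projL k X.carrier Y.carrier ∘ₗ BP.circ.antipode =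
          X.brace.circ.antipode ∘ₗ projL k X.carrier Y.carrier) ∧
        (projR k X.carrier Y.carrier ∘ₗ BP.dot.mul = Y.brace.dot.mul ∘ₗ
          TensorProduct.map (projR k X.carrier Y.carrier) (projR k X.carrier Y.carrier)) ∧
        (projR k X.carrier Y.carrier BP.dot.one = Y.brace.dot.one) ∧
        (projR k X.carrier Y.carrier ∘ₗ BP.dot.antipode =
          Y.brace.dot.antipode ∘ₗ projR k X.carrier Y.carrier) ∧
        (projR k X.carrier Y.carrier ∘ₗ BP.circ.mul = Y.brace.circ.mul ∘ₗ
          TensorProduct.map (projR k X.carrier Y.carrier) (projR k X.carrier Y.carrier)) ∧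
        (projR k X.carrier Y.carrier BP.circ.one = Y.brace.circ.one) ∧
        (projR k X.carrier Y.carrier ∘ₗ BP.circ.antipode =
          Y.brace.circ.antipode ∘ₗ projR k X.carrier Y.carrier) ∧
        -- the tensor product, with the coalgebra projections, is a categorical product
        ∃ (q1 : CocommHopfBraceCat.mk (X.carrier ⊗[k] Y.carrier) BP hcc ⟶ X)
          (q2 : CocommHopfBraceCat.mk (X.carrier ⊗[k] Y.carrier) BP hcc ⟶ Y),
          q1.1 = projL k X.carrier Y.carrier ∧
          q2.1 = projR k X.carrier Y.carrier ∧
          Nonempty (CategoryTheory.Limits.IsLimit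
            (CategoryTheory.Limits.BinaryFan.mk q1 q2)) := by
  refine ⟨CocommHopfBraceCat.hasLimits, fun X Y => ?_⟩
  obtain ⟨BP, hX, hY, hP⟩ := exists_tensor_brace X Y
  have hcc : IsCocomm k (X.carrier ⊗[k] Y.carrier) := Coalgebra.IsCocomm.comm_comp_comul
  have h1 := IsHopfBraceHom.of_isHom (BV := BP) (BW := X.brace)
    (projLHom X.carrier Y.carrier) hX.1 hX.2
  have h2 := IsHopfBraceHom.of_isHom (BV := BP) (BW := Y.brace)
    (projRHom X.carrier Y.carrier) hY.1 hY.2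
  refine ⟨BP, hcc, TensorProduct.ext' hX.1.map_mul, hX.1.map_one,
    LinearMap.ext hX.1.map_antipode, TensorProduct.ext' hX.2.map_mul, hX.2.map_one,
    LinearMap.ext hX.2.map_antipode, TensorProduct.ext' hY.1.map_mul, hY.1.map_one,
    LinearMap.ext hY.1.map_antipode, TensorProduct.ext' hY.2.map_mul, hY.2.map_one,
    LinearMap.ext hY.2.map_antipode, ⟨_, h1⟩, ⟨_, h2⟩, rfl, rfl, ?_⟩
  choose l hl hl1 hl2 hu using hP
  exact ⟨CategoryTheory.Limits.BinaryFan.isLimitMk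
    (fun s => ⟨l s.pt s.fst s.snd, hl s.pt s.fst s.snd⟩)
    (fun s => Subtype.ext (hl1 s.pt s.fst s.snd)) (fun s => Subtype.ext (hl2 s.pt s.fst s.snd))
    fun s m e1 e2 => Subtype.ext (hu s.pt s.fst s.snd m.1 m.2
      (congrArg Subtype.val e1) (congrArg Subtype.val e2))⟩

end HopfBraceNL
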